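/- Fix i, j ∈ {1,2,3} with j ≠ i, and set β_j = 0 in the generalized Kepler–Coulomb Hamiltonian H^GKC_i (which already involves no βᵢ). Then both functions Lᵢ and L_j (with β_j = 0 substituted in their formulas) Poisson commute with H^GKC_i at every point of D. -/

import Mathlib

namespace Paper
noncomputable section

/-- The κ-dependent cosine Cκ(x) = ∑ (−κ)^l x^{2l}/(2l)!. -/
def Ck (κ x : ℝ) : ℝ := ∑' l : ℕ, (-κ) ^ l * x ^ (2 * l) / (Nat.factorial (2 * l) : ℝ)

/-- The κ-dependent sine Sκ(x) = ∑ (−κ)^l x^{2l+1}/(2l+1)!. -/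
def Sk (κ x : ℝ) : ℝ := ∑' l : ℕ, (-κ) ^ l * x ^ (2 * l + 1) / (Nat.factorial (2 * l + 1) : ℝ)

/-- The κ-dependent tangent Tκ(x) = Sκ(x)/Cκ(x). -/
def Tk (κ x : ℝ) : ℝ := Sk κ x / Ck κ x

/-- Phase space ℝ³ × ℝ³ ≃ ℝ⁶ with canonical coordinates
`(r, θ, φ, p_r, p_θ, p_φ) = (x 0, x 1, x 2, x 3, x 4, x 5)`. -/
abbrev Pt := Fin 6 → ℝ

/-- Partial derivative in the i-th coordinate direction. -/
def pd (f : Pt → ℝ) (i : Fin 6) (x : Pt) : ℝ := fderiv ℝ f x (Pi.single i 1)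

/-- Canonical Poisson bracket {f,g} = ∑_{q} (∂f/∂q ∂g/∂p_q − ∂g/∂q ∂f/∂p_q). -/
def pb (f g : Pt → ℝ) (x : Pt) : ℝ :=
  ∑ i : Fin 3,
    (pd f ⟨i.1, by omega⟩ x * pd g ⟨i.1 + 3, by omega⟩ x
      - pd g ⟨i.1, by omega⟩ x * pd f ⟨i.1 + 3, by omega⟩ x)

/-- Gradient of a function on phase space, as a vector in ℝ⁶. -/
def grad (f : Pt → ℝ) (x : Pt) : Fin 6 → ℝ := fun i => pd f i x

/-- The open domain D where Sκ₁(r), Cκ₁(r), Sκ₂(θ), Cκ₂(θ), cos φ, sin φ are nonzero. -/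
def D (κ₁ κ₂ : ℝ) : Set Pt :=
  {x | Sk κ₁ (x 0) ≠ 0 ∧ Ck κ₁ (x 0) ≠ 0 ∧ Sk κ₂ (x 1) ≠ 0 ∧ Ck κ₂ (x 1) ≠ 0 ∧
       Real.cos (x 2) ≠ 0 ∧ Real.sin (x 2) ≠ 0}

/-- J₀₁ = Cκ₂(θ)p_r − (Sκ₂(θ)/Tκ₁(r))p_θ. -/
def J01 (κ₁ κ₂ : ℝ) (x : Pt) : ℝ :=
  Ck κ₂ (x 1) * x 3 - (Sk κ₂ (x 1) / Tk κ₁ (x 0)) * x 4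

/-- J₀₂. -/
def J02 (κ₁ κ₂ : ℝ) (x : Pt) : ℝ :=
  κ₂ * Sk κ₂ (x 1) * Real.cos (x 2) * x 3
    + (Ck κ₂ (x 1) * Real.cos (x 2) / Tk κ₁ (x 0)) * x 4
    - (Real.sin (x 2) / (Tk κ₁ (x 0) * Sk κ₂ (x 1))) * x 5

/-- J₀₃. -/
def J03 (κ₁ κ₂ : ℝ) (x : Pt) : ℝ :=
  κ₂ * Sk κ₂ (x 1) * Real.sin (x 2) * x 3
    + (Ck κ₂ (x 1) * Real.sin (x 2) / Tk κ₁ (x 0)) * x 4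
    + (Real.cos (x 2) / (Tk κ₁ (x 0) * Sk κ₂ (x 1))) * x 5

/-- J₁₂ = cos φ·p_θ − (sin φ/Tκ₂(θ))p_φ. -/
def J12 (κ₂ : ℝ) (x : Pt) : ℝ :=
  Real.cos (x 2) * x 4 - (Real.sin (x 2) / Tk κ₂ (x 1)) * x 5

/-- J₁₃ = sin φ·p_θ + (cos φ/Tκ₂(θ))p_φ. -/
def J13 (κ₂ : ℝ) (x : Pt) : ℝ :=
  Real.sin (x 2) * x 4 + (Real.cos (x 2) / Tk κ₂ (x 1)) * x 5

/-- J₂₃ = p_φ. -/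
def J23 (x : Pt) : ℝ := x 5

/-- Kinetic energy T. -/
def Tkin (κ₁ κ₂ : ℝ) (x : Pt) : ℝ :=
  (1 / 2) * ((x 3) ^ 2 + (x 4) ^ 2 / (κ₂ * Sk κ₁ (x 0) ^ 2)
    + (x 5) ^ 2 / (κ₂ * Sk κ₁ (x 0) ^ 2 * Sk κ₂ (x 1) ^ 2))

/-- The superintegrable potential U with arbitrary radial function F. -/
def U (κ₁ κ₂ : ℝ) (F : ℝ → ℝ) (β₁ β₂ β₃ : ℝ) (x : Pt) : ℝ :=
  F (x 0) + (1 / Sk κ₁ (x 0) ^ 2) *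
    (β₁ / Ck κ₂ (x 1) ^ 2 + β₂ / (Sk κ₂ (x 1) ^ 2 * Real.cos (x 2) ^ 2)
      + β₃ / (Sk κ₂ (x 1) ^ 2 * Real.sin (x 2) ^ 2))

/-- Integral I₁₂. -/
def I12 (κ₂ β₁ β₂ : ℝ) (x : Pt) : ℝ :=
  (Real.cos (x 2) * x 4 - (Real.sin (x 2) / Tk κ₂ (x 1)) * x 5) ^ 2
    + 2 * β₁ * κ₂ ^ 2 * Tk κ₂ (x 1) ^ 2 * Real.cos (x 2) ^ 2
    + 2 * β₂ * κ₂ / (Tk κ₂ (x 1) ^ 2 * Real.cos (x 2) ^ 2)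

/-- Integral I₁₃. -/
def I13 (κ₂ β₁ β₃ : ℝ) (x : Pt) : ℝ :=
  (Real.sin (x 2) * x 4 + (Real.cos (x 2) / Tk κ₂ (x 1)) * x 5) ^ 2
    + 2 * β₁ * κ₂ ^ 2 * Tk κ₂ (x 1) ^ 2 * Real.sin (x 2) ^ 2
    + 2 * β₃ * κ₂ / (Tk κ₂ (x 1) ^ 2 * Real.sin (x 2) ^ 2)

/-- Integral I₂₃. -/
def I23 (κ₂ β₂ β₃ : ℝ) (x : Pt) : ℝ :=
  (x 5) ^ 2 + 2 * β₂ * κ₂ * Real.tan (x 2) ^ 2 + 2 * β₃ * κ₂ / Real.tan (x 2) ^ 2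

/-- Integral I₁₂₃. -/
def I123 (κ₂ β₁ β₂ β₃ : ℝ) (x : Pt) : ℝ :=
  (x 4) ^ 2 + (x 5) ^ 2 / Sk κ₂ (x 1) ^ 2 + 2 * β₁ * κ₂ / Ck κ₂ (x 1) ^ 2
    + 2 * β₂ * κ₂ / (Sk κ₂ (x 1) ^ 2 * Real.cos (x 2) ^ 2)
    + 2 * β₃ * κ₂ / (Sk κ₂ (x 1) ^ 2 * Real.sin (x 2) ^ 2)

/-- The Smorodinsky–Winternitz Hamiltonian H^SW. -/
def HSW (κ₁ κ₂ β₀ β₁ β₂ β₃ : ℝ) (x : Pt) : ℝ :=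
  Tkin κ₁ κ₂ x + β₀ * Tk κ₁ (x 0) ^ 2 + (1 / Sk κ₁ (x 0) ^ 2) *
    (β₁ / Ck κ₂ (x 1) ^ 2 + β₂ / (Sk κ₂ (x 1) ^ 2 * Real.cos (x 2) ^ 2)
      + β₃ / (Sk κ₂ (x 1) ^ 2 * Real.sin (x 2) ^ 2))

/-- Integral I₀₁ of H^SW. -/
def I01 (κ₁ κ₂ β₀ β₁ : ℝ) (x : Pt) : ℝ :=
  J01 κ₁ κ₂ x ^ 2 + 2 * β₀ * Tk κ₁ (x 0) ^ 2 * Ck κ₂ (x 1) ^ 2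
    + 2 * β₁ / (Tk κ₁ (x 0) ^ 2 * Ck κ₂ (x 1) ^ 2)

/-- Integral I₀₂ of H^SW. -/
def I02 (κ₁ κ₂ β₀ β₂ : ℝ) (x : Pt) : ℝ :=
  J02 κ₁ κ₂ x ^ 2 + 2 * β₀ * κ₂ ^ 2 * Tk κ₁ (x 0) ^ 2 * Sk κ₂ (x 1) ^ 2 * Real.cos (x 2) ^ 2
    + 2 * β₂ * κ₂ / (Tk κ₁ (x 0) ^ 2 * Sk κ₂ (x 1) ^ 2 * Real.cos (x 2) ^ 2)

/-- Integral I₀₃ of H^SW. -/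
def I03 (κ₁ κ₂ β₀ β₃ : ℝ) (x : Pt) : ℝ :=
  J03 κ₁ κ₂ x ^ 2 + 2 * β₀ * κ₂ ^ 2 * Tk κ₁ (x 0) ^ 2 * Sk κ₂ (x 1) ^ 2 * Real.sin (x 2) ^ 2
    + 2 * β₃ * κ₂ / (Tk κ₁ (x 0) ^ 2 * Sk κ₂ (x 1) ^ 2 * Real.sin (x 2) ^ 2)

/-- Generalized Kepler–Coulomb Hamiltonian H^GKC₁ = T + U^GKC₁. -/
def HGKC1 (κ₁ κ₂ k β₂ β₃ : ℝ) (x : Pt) : ℝ :=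
  Tkin κ₁ κ₂ x - k / Tk κ₁ (x 0)
    + (1 / (Sk κ₁ (x 0) ^ 2 * Sk κ₂ (x 1) ^ 2)) *
        (β₂ / Real.cos (x 2) ^ 2 + β₃ / Real.sin (x 2) ^ 2)

/-- Generalized Kepler–Coulomb Hamiltonian H^GKC₂ = T + U^GKC₂. -/
def HGKC2 (κ₁ κ₂ k β₁ β₃ : ℝ) (x : Pt) : ℝ :=
  Tkin κ₁ κ₂ x - k / Tk κ₁ (x 0)
    + (1 / Sk κ₁ (x 0) ^ 2) *
        (β₁ / Ck κ₂ (x 1) ^ 2 + β₃ / (Sk κ₂ (x 1) ^ 2 * Real.sin (x 2) ^ 2))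

/-- Generalized Kepler–Coulomb Hamiltonian H^GKC₃ = T + U^GKC₃. -/
def HGKC3 (κ₁ κ₂ k β₁ β₂ : ℝ) (x : Pt) : ℝ :=
  Tkin κ₁ κ₂ x - k / Tk κ₁ (x 0)
    + (1 / Sk κ₁ (x 0) ^ 2) *
        (β₁ / Ck κ₂ (x 1) ^ 2 + β₂ / (Sk κ₂ (x 1) ^ 2 * Real.cos (x 2) ^ 2))

/-- The function L₁. -/
def L1 (κ₁ κ₂ k β₂ β₃ : ℝ) (x : Pt) : ℝ :=
  -(J02 κ₁ κ₂ x * J12 κ₂ x) - J03 κ₁ κ₂ x * J13 κ₂ x + k * κ₂ * Ck κ₂ (x 1)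
    - (2 * κ₂ * Ck κ₂ (x 1) / (Tk κ₁ (x 0) * Sk κ₂ (x 1) ^ 2)) *
        (β₂ / Real.cos (x 2) ^ 2 + β₃ / Real.sin (x 2) ^ 2)

/-- The function L₂. -/
def L2 (κ₁ κ₂ k β₁ β₃ : ℝ) (x : Pt) : ℝ :=
  J01 κ₁ κ₂ x * J12 κ₂ x - J03 κ₁ κ₂ x * J23 x + k * κ₂ * Sk κ₂ (x 1) * Real.cos (x 2)
    - (2 * κ₂ * Real.cos (x 2) / Tk κ₁ (x 0)) *
        (β₁ * Sk κ₂ (x 1) / Ck κ₂ (x 1) ^ 2 + β₃ / (Sk κ₂ (x 1) * Real.sin (x 2) ^ 2))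

/-- The function L₃. -/
def L3 (κ₁ κ₂ k β₁ β₂ : ℝ) (x : Pt) : ℝ :=
  J01 κ₁ κ₂ x * J13 κ₂ x + J02 κ₁ κ₂ x * J23 x + k * κ₂ * Sk κ₂ (x 1) * Real.sin (x 2)
    - (2 * κ₂ * Real.sin (x 2) / Tk κ₁ (x 0)) *
        (β₁ * Sk κ₂ (x 1) / Ck κ₂ (x 1) ^ 2 + β₂ / (Sk κ₂ (x 1) * Real.cos (x 2) ^ 2))

theorem Ck_sq_mul (a x : ℝ) : Ck (a ^ 2) x = Real.cos (a * x) := by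
  rw [Ck, ← (Real.hasSum_cos (a * x)).tsum_eq]
  congr 1; ext l
  rw [neg_pow, mul_pow, ← pow_mul, mul_assoc]

theorem mul_Sk_sq (a x : ℝ) : a * Sk (a ^ 2) x = Real.sin (a * x) := by
  rw [Sk, ← (Real.hasSum_sin (a * x)).tsum_eq, ← tsum_mul_left]
  congr 1; ext l
  rw [neg_pow, mul_pow, ← pow_mul]
  ring

theorem Ck_neg_sq (a x : ℝ) : Ck (-a ^ 2) x = Real.cosh (a * x) := by
  rw [Ck, ← (Real.hasSum_cosh (a * x)).tsum_eq]
  congr 1; ext l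
  rw [neg_neg, mul_pow, ← pow_mul]

theorem mul_Sk_neg_sq (a x : ℝ) : a * Sk (-a ^ 2) x = Real.sinh (a * x) := by
  rw [Sk, ← (Real.hasSum_sinh (a * x)).tsum_eq, ← tsum_mul_left]
  congr 1; ext l
  rw [neg_neg, mul_pow, ← pow_mul]
  ring

theorem Ck_zero (x : ℝ) : Ck 0 x = 1 := by
  rw [Ck, tsum_eq_single 0 (fun l hl => by simp [hl])]
  simp

theorem Sk_zero (x : ℝ) : Sk 0 x = x := by
  rw [Sk, tsum_eq_single 0 (fun l hl => by simp [hl])]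
  simp

/-- Every real number is zero, a nonzero square, or minus a nonzero square. -/
theorem eq_zero_or_sq_or_neg_sq (κ : ℝ) :
    κ = 0 ∨ (∃ a : ℝ, a ≠ 0 ∧ κ = a ^ 2) ∨ ∃ a : ℝ, a ≠ 0 ∧ κ = -a ^ 2 := by
  rcases lt_trichotomy κ 0 with h | h | h
  · exact .inr (.inr ⟨√(-κ), (Real.sqrt_pos.2 (neg_pos.2 h)).ne', by
      rw [Real.sq_sqrt (neg_pos.2 h).le, neg_neg]⟩)
  · exact .inl h
  · exact .inr (.inl ⟨√κ, (Real.sqrt_pos.2 h).ne', (Real.sq_sqrt h.le).symm⟩)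

theorem Ck_sq_add (κ x : ℝ) : Ck κ x ^ 2 + κ * Sk κ x ^ 2 = 1 := by
  rcases eq_zero_or_sq_or_neg_sq κ with rfl | ⟨a, -, rfl⟩ | ⟨a, -, rfl⟩
  · simp [Ck_zero]
  · rw [← mul_pow, mul_Sk_sq, Ck_sq_mul, Real.cos_sq_add_sin_sq]
  · rw [neg_mul, ← mul_pow, mul_Sk_neg_sq, Ck_neg_sq, ← sub_eq_add_neg, Real.cosh_sq_sub_sinh_sq]

theorem hasDerivAt_Sk (κ x : ℝ) : HasDerivAt (Sk κ) (Ck κ x) x := by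
  have hm (a : ℝ) : HasDerivAt (fun y => a * y) a x := by
    simpa using (hasDerivAt_id x).const_mul a
  rcases eq_zero_or_sq_or_neg_sq κ with rfl | ⟨a, ha, rfl⟩ | ⟨a, ha, rfl⟩
  · rw [Ck_zero, funext Sk_zero]
    exact hasDerivAt_id' x
  · have h : Sk (a ^ 2) = fun y => Real.sin (a * y) / a := by
      ext y; rw [← mul_Sk_sq, mul_div_cancel_left₀ _ ha]
    rw [h, Ck_sq_mul]
    simpa [ha] using (hm a).sin.div_const a
  · have h : Sk (-a ^ 2) = fun y => Real.sinh (a * y) / a := by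
      ext y; rw [← mul_Sk_neg_sq, mul_div_cancel_left₀ _ ha]
    rw [h, Ck_neg_sq]
    simpa [ha] using (hm a).sinh.div_const a

theorem hasDerivAt_Ck (κ x : ℝ) : HasDerivAt (Ck κ) (-(κ * Sk κ x)) x := by
  have hm (a : ℝ) : HasDerivAt (fun y => a * y) a x := by
    simpa using (hasDerivAt_id x).const_mul a
  rcases eq_zero_or_sq_or_neg_sq κ with rfl | ⟨a, -, rfl⟩ | ⟨a, -, rfl⟩
  · rw [funext Ck_zero]
    simpa using hasDerivAt_const x (1 : ℝ)
  · rw [funext (Ck_sq_mul a)]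
    refine (hm a).cos.congr_deriv ?_
    rw [← mul_Sk_sq]; ring
  · rw [funext (Ck_neg_sq a)]
    refine (hm a).cosh.congr_deriv ?_
    rw [← mul_Sk_neg_sq]; ring

/-- The derivative of `1 / Tκ`. -/
theorem hasDerivAt_Ck_div_Sk {κ x : ℝ} (h : Sk κ x ≠ 0) :
    HasDerivAt (fun y => Ck κ y / Sk κ y) (-(1 / Sk κ x ^ 2)) x := by
  refine ((hasDerivAt_Ck κ x).div (hasDerivAt_Sk κ x) h).congr_deriv ?_
  field_simp
  linear_combination -Ck_sq_add κ x

theorem hasDerivAt_inv_Sk_sq {κ x : ℝ} (h : Sk κ x ≠ 0) :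
    HasDerivAt (fun y => (Sk κ y ^ 2)⁻¹) (-2 * (Sk κ x ^ 2)⁻¹ * (Ck κ x / Sk κ x)) x := by
  refine (((hasDerivAt_Sk κ x).fun_pow 2).fun_inv (pow_ne_zero 2 h)).congr_deriv ?_
  push_cast
  field_simp

/-- A function of a single coordinate, as a function on phase space. -/
theorem hasFDerivAt_comp_apply {f : ℝ → ℝ} {f' : ℝ} {x : Pt} (i : Fin 6)
    (h : HasDerivAt f f' (x i)) :
    HasFDerivAt (fun y : Pt => f (y i)) (f' • (ContinuousLinearMap.proj i : Pt →L[ℝ] ℝ)) x :=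
  h.comp_hasFDerivAt x (hasFDerivAt_apply i x)

theorem pb_eq (f g : Pt → ℝ) (x : Pt) :
    pb f g x = (pd f 0 x * pd g 3 x - pd g 0 x * pd f 3 x)
      + (pd f 1 x * pd g 4 x - pd g 1 x * pd f 4 x)
      + (pd f 2 x * pd g 5 x - pd g 2 x * pd f 5 x) := by
  rw [pb, Fin.sum_univ_three]
  rfl

theorem pb_congr_left {f₁ f₂ : Pt → ℝ} {x : Pt} (h : f₁ =ᶠ[nhds x] f₂) (g : Pt → ℝ) :
    pb f₁ g x = pb f₂ g x := by
  simp only [pb, pd, h.fderiv_eq]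

/-- If `Z` and `X` are functions of the angular variables with `κ₂{Z, N} = X` and
`{X, N} = -2κ₂ZN` for an angular energy `N`, then the associated Laplace–Runge–Lenz function
Poisson commutes with the Kepler–Coulomb Hamiltonian with angular energy `N`. -/
theorem pb_laplaceRungeLenz (κ₁ κ₂ k : ℝ) {Z X N : Pt → ℝ} {x : Pt} (hS : Sk κ₁ (x 0) ≠ 0)
    (hZ : DifferentiableAt ℝ Z x) (hX : DifferentiableAt ℝ X x) (hN : DifferentiableAt ℝ N x)
    (hZ₀ : pd Z 0 x = 0) (hZ₃ : pd Z 3 x = 0) (hX₀ : pd X 0 x = 0) (hX₃ : pd X 3 x = 0)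
    (hN₀ : pd N 0 x = 0) (hN₃ : pd N 3 x = 0)
    (hZN : κ₂ * pb Z N x = X x) (hXN : pb X N x = -(2 * κ₂ * Z x * N x)) :
    pb (fun y => y 3 * X y - 2 * κ₂ * (Ck κ₁ (y 0) / Sk κ₁ (y 0)) * (Z y * N y) + k * κ₂ * Z y)
      (fun y => 1 / 2 * y 3 ^ 2 + (Sk κ₁ (y 0) ^ 2)⁻¹ * N y - k * (Ck κ₁ (y 0) / Sk κ₁ (y 0))) x
      = 0 := by
  have hw := hasFDerivAt_comp_apply 0 (hasDerivAt_Ck_div_Sk hS)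
  have hv := hasFDerivAt_comp_apply 0 (hasDerivAt_inv_Sk_sq hS)
  have hp := hasFDerivAt_comp_apply 3 (hasDerivAt_id' (x 3))
  have hq := hasFDerivAt_comp_apply 3 ((hasDerivAt_id' (x 3)).fun_pow 2)
  have hL := ((hp.fun_mul hX.hasFDerivAt).fun_sub ((hw.const_mul (2 * κ₂)).fun_mul
    (hZ.hasFDerivAt.fun_mul hN.hasFDerivAt))).fun_add (hZ.hasFDerivAt.const_mul (k * κ₂))
  have hH := ((hq.const_mul (1 / 2)).fun_add (hv.fun_mul hN.hasFDerivAt)).fun_sub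
    (hw.const_mul k)
  rw [pb_eq] at hZN hXN ⊢
  simp only [pd] at *
  rw [hL.fderiv, hH.fderiv]
  simp [hZ₀, hZ₃, hX₀, hX₃, hN₀, hN₃] at hZN hXN ⊢
  linear_combination (x 3 * (Sk κ₁ (x 0) ^ 2)⁻¹) * hXN
    + ((Sk κ₁ (x 0) ^ 2)⁻¹ * (k - 2 * (Ck κ₁ (x 0) / Sk κ₁ (x 0)) * N x)) * hZN

/-- The angular part of the Kepler–Coulomb Hamiltonian. -/
def angularEnergy (κ₂ β₁ β₂ β₃ : ℝ) (x : Pt) : ℝ :=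
  (2 * κ₂)⁻¹ * (x 4 ^ 2 + (Sk κ₂ (x 1) ^ 2)⁻¹ * x 5 ^ 2) + β₁ * (Ck κ₂ (x 1) ^ 2)⁻¹
    + (Sk κ₂ (x 1) ^ 2)⁻¹ *
      (β₂ * (Real.cos (x 2) ^ 2)⁻¹ + β₃ * (Real.sin (x 2) ^ 2)⁻¹)

/-- The differential of the angular energy. -/
theorem hasFDerivAt_angularEnergy {κ₁ κ₂ : ℝ} (β₁ β₂ β₃ : ℝ) {x : Pt} (hκ₂ : κ₂ ≠ 0)
    (hx : x ∈ D κ₁ κ₂) :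
    HasFDerivAt (angularEnergy κ₂ β₁ β₂ β₃)
      ((2 * κ₂ * β₁ * Sk κ₂ (x 1) / Ck κ₂ (x 1) ^ 3
          - 2 * Ck κ₂ (x 1) / Sk κ₂ (x 1) ^ 3
            * (x 5 ^ 2 / (2 * κ₂) + β₂ / Real.cos (x 2) ^ 2 + β₃ / Real.sin (x 2) ^ 2))
          • (ContinuousLinearMap.proj 1 : Pt →L[ℝ] ℝ)
        + (2 * (β₂ * Real.sin (x 2) / Real.cos (x 2) ^ 3
            - β₃ * Real.cos (x 2) / Real.sin (x 2) ^ 3) / Sk κ₂ (x 1) ^ 2)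
          • (ContinuousLinearMap.proj 2 : Pt →L[ℝ] ℝ)
        + (x 4 / κ₂) • (ContinuousLinearMap.proj 4 : Pt →L[ℝ] ℝ)
        + (x 5 / (κ₂ * Sk κ₂ (x 1) ^ 2)) • (ContinuousLinearMap.proj 5 : Pt →L[ℝ] ℝ)) x := by
  obtain ⟨-, -, hS, hC, hc, hs⟩ := hx
  have h1 := hasFDerivAt_comp_apply 1 (hasDerivAt_inv_Sk_sq hS)
  have h2 := hasFDerivAt_comp_apply 1
    (((hasDerivAt_Ck κ₂ (x 1)).fun_pow 2).fun_inv (pow_ne_zero 2 hC))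
  have h3 := hasFDerivAt_comp_apply 2
    (((Real.hasDerivAt_cos (x 2)).fun_pow 2).fun_inv (pow_ne_zero 2 hc))
  have h4 := hasFDerivAt_comp_apply 2
    (((Real.hasDerivAt_sin (x 2)).fun_pow 2).fun_inv (pow_ne_zero 2 hs))
  have h5 := hasFDerivAt_comp_apply 4 ((hasDerivAt_id' (x 4)).fun_pow 2)
  have h6 := hasFDerivAt_comp_apply 5 ((hasDerivAt_id' (x 5)).fun_pow 2)
  refine ((((h5.fun_add (h1.fun_mul h6)).const_mul (2 * κ₂)⁻¹).fun_add (h2.const_mul β₁)).fun_add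
    (h1.fun_mul ((h3.const_mul β₂).fun_add (h4.const_mul β₃)))).congr_fderiv ?_
  ext y
  simp
  field_simp
  ring

theorem HGKC1_eq (κ₁ κ₂ k β₂ β₃ : ℝ) : HGKC1 κ₁ κ₂ k β₂ β₃ = fun y =>
    1 / 2 * y 3 ^ 2 + (Sk κ₁ (y 0) ^ 2)⁻¹ * angularEnergy κ₂ 0 β₂ β₃ y
      - k * (Ck κ₁ (y 0) / Sk κ₁ (y 0)) := by
  ext y
  simp only [HGKC1, Tkin, Tk, angularEnergy, div_div_eq_mul_div]
  ring

theorem HGKC2_eq (κ₁ κ₂ k β₁ β₃ : ℝ) : HGKC2 κ₁ κ₂ k β₁ β₃ = fun y =>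
    1 / 2 * y 3 ^ 2 + (Sk κ₁ (y 0) ^ 2)⁻¹ * angularEnergy κ₂ β₁ 0 β₃ y
      - k * (Ck κ₁ (y 0) / Sk κ₁ (y 0)) := by
  ext y
  simp only [HGKC2, Tkin, Tk, angularEnergy, div_div_eq_mul_div]
  ring

theorem HGKC3_eq (κ₁ κ₂ k β₁ β₂ : ℝ) : HGKC3 κ₁ κ₂ k β₁ β₂ = fun y =>
    1 / 2 * y 3 ^ 2 + (Sk κ₁ (y 0) ^ 2)⁻¹ * angularEnergy κ₂ β₁ β₂ 0 y
      - k * (Ck κ₁ (y 0) / Sk κ₁ (y 0)) := by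
  ext y
  simp only [HGKC3, Tkin, Tk, angularEnergy, div_div_eq_mul_div]
  ring

theorem eventually_Sk_ne_zero {κ : ℝ} {x : Pt} (i : Fin 6) (h : Sk κ (x i) ≠ 0) :
    ∀ᶠ y in nhds x, Sk κ (y i) ≠ 0 :=
  (hasFDerivAt_comp_apply i (hasDerivAt_Sk κ (x i))).continuousAt.eventually_ne h

theorem pb_L1_HGKC1 {κ₁ κ₂ : ℝ} (k β₂ β₃ : ℝ) (hκ₂ : κ₂ ≠ 0) {x : Pt} (hx : x ∈ D κ₁ κ₂) :
    pb (L1 κ₁ κ₂ k β₂ β₃) (HGKC1 κ₁ κ₂ k β₂ β₃) x = 0 := by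
  have hN := hasFDerivAt_angularEnergy 0 β₂ β₃ hκ₂ hx
  obtain ⟨hr, -, hS, hC, hc, hs⟩ := hx
  have hZ := hasFDerivAt_comp_apply 1 (hasDerivAt_Ck κ₂ (x 1))
  have hX := ((hasFDerivAt_comp_apply 1 (hasDerivAt_Sk κ₂ (x 1))).const_mul (-κ₂)).fun_mul
    (hasFDerivAt_comp_apply 4 (hasDerivAt_id' (x 4)))
  have hL : L1 κ₁ κ₂ k β₂ β₃ = fun y => y 3 * (-κ₂ * Sk κ₂ (y 1) * y 4)
      - 2 * κ₂ * (Ck κ₁ (y 0) / Sk κ₁ (y 0)) * (Ck κ₂ (y 1) * angularEnergy κ₂ 0 β₂ β₃ y)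
      + k * κ₂ * Ck κ₂ (y 1) := by
    ext y
    simp only [L1, J02, J03, J12, J13, Tk, angularEnergy, mul_inv, div_eq_mul_inv, inv_inv]
    linear_combination
      (Ck κ₁ (y 0) * (Sk κ₁ (y 0))⁻¹ * Ck κ₂ (y 1)
        * (y 4 ^ 2 + (Sk κ₂ (y 1) ^ 2)⁻¹ * y 5 ^ 2)) * mul_inv_cancel₀ hκ₂
      - (κ₂ * Sk κ₂ (y 1) * y 3 * y 4 + Ck κ₁ (y 0) * (Sk κ₁ (y 0))⁻¹ * Ck κ₂ (y 1)
        * (y 4 ^ 2 + (Sk κ₂ (y 1) ^ 2)⁻¹ * y 5 ^ 2)) * Real.cos_sq_add_sin_sq (y 2)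
  rw [hL, HGKC1_eq]
  refine pb_laplaceRungeLenz κ₁ κ₂ k hr hZ.differentiableAt hX.differentiableAt
    hN.differentiableAt ?_ ?_ ?_ ?_ ?_ ?_ ?_ ?_
  all_goals simp only [pb_eq, pd, hZ.fderiv, hX.fderiv, hN.fderiv]
  all_goals simp
  · field_simp
  · simp only [angularEnergy]
    field_simp
    ring

theorem pb_L2_HGKC2 {κ₁ κ₂ : ℝ} (k β₁ β₃ : ℝ) (hκ₂ : κ₂ ≠ 0) {x : Pt} (hx : x ∈ D κ₁ κ₂) :
    pb (L2 κ₁ κ₂ k β₁ β₃) (HGKC2 κ₁ κ₂ k β₁ β₃) x = 0 := by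
  have hN := hasFDerivAt_angularEnergy β₁ 0 β₃ hκ₂ hx
  obtain ⟨hr, -, hS, hC, hc, hs⟩ := hx
  have h4 := hasFDerivAt_comp_apply 4 (hasDerivAt_id' (x 4))
  have h5 := hasFDerivAt_comp_apply 5 (hasDerivAt_id' (x 5))
  have hcos := hasFDerivAt_comp_apply 2 (Real.hasDerivAt_cos (x 2))
  have hsin := hasFDerivAt_comp_apply 2 (Real.hasDerivAt_sin (x 2))
  have hZ := (hasFDerivAt_comp_apply 1 (hasDerivAt_Sk κ₂ (x 1))).fun_mul hcos
  have hX := (((hasFDerivAt_comp_apply 1 (hasDerivAt_Ck κ₂ (x 1))).fun_mul hcos).fun_mul h4).fun_sub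
    ((hsin.fun_mul (hasFDerivAt_comp_apply 1 ((hasDerivAt_Sk κ₂ (x 1)).fun_inv hS))).fun_mul h5)
  have hL : L2 κ₁ κ₂ k β₁ β₃ =ᶠ[nhds x] fun y =>
      y 3 * (Ck κ₂ (y 1) * Real.cos (y 2) * y 4 - Real.sin (y 2) * (Sk κ₂ (y 1))⁻¹ * y 5)
      - 2 * κ₂ * (Ck κ₁ (y 0) / Sk κ₁ (y 0))
        * (Sk κ₂ (y 1) * Real.cos (y 2) * angularEnergy κ₂ β₁ 0 β₃ y)
      + k * κ₂ * (Sk κ₂ (y 1) * Real.cos (y 2)) := by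
    filter_upwards [eventually_Sk_ne_zero 1 hS] with y hS
    simp only [L2, J01, J03, J12, J23, Tk, angularEnergy, mul_inv, div_eq_mul_inv, inv_inv]
    linear_combination
      (Ck κ₁ (y 0) * (Sk κ₁ (y 0))⁻¹ * Sk κ₂ (y 1) * Real.cos (y 2)
        * (y 4 ^ 2 + (Sk κ₂ (y 1) ^ 2)⁻¹ * y 5 ^ 2)) * mul_inv_cancel₀ hκ₂
      - (y 3 * y 5 * Real.sin (y 2) * (Sk κ₂ (y 1))⁻¹) * Ck_sq_add κ₂ (y 1)
      + (y 3 * y 5 * Real.sin (y 2) * κ₂ * Sk κ₂ (y 1)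
        + Ck κ₁ (y 0) * (Sk κ₁ (y 0))⁻¹ * (Real.sin (y 2) * Ck κ₂ (y 1) * y 4 * y 5
          + Real.cos (y 2) * y 5 ^ 2 * (Sk κ₂ (y 1))⁻¹
          + 2 * κ₂ * β₃ * Real.cos (y 2) * (Real.sin (y 2) ^ 2)⁻¹ * (Sk κ₂ (y 1))⁻¹))
        * mul_inv_cancel₀ hS
  rw [pb_congr_left hL, HGKC2_eq]
  refine pb_laplaceRungeLenz κ₁ κ₂ k hr hZ.differentiableAt hX.differentiableAt
    hN.differentiableAt ?_ ?_ ?_ ?_ ?_ ?_ ?_ ?_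
  all_goals simp only [pb_eq, pd, hZ.fderiv, hX.fderiv, hN.fderiv]
  all_goals simp
  · field_simp
    ring
  · simp only [angularEnergy]
    linear_combination (norm := (field_simp; ring))
      (2 * Real.cos (x 2) / Sk κ₂ (x 1) ^ 3
        * (x 5 ^ 2 / (2 * κ₂) + β₃ / Real.sin (x 2) ^ 2)) * Ck_sq_add κ₂ (x 1)

theorem pb_L3_HGKC3 {κ₁ κ₂ : ℝ} (k β₁ β₂ : ℝ) (hκ₂ : κ₂ ≠ 0) {x : Pt} (hx : x ∈ D κ₁ κ₂) :
    pb (L3 κ₁ κ₂ k β₁ β₂) (HGKC3 κ₁ κ₂ k β₁ β₂) x = 0 := by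
  have hN := hasFDerivAt_angularEnergy β₁ β₂ 0 hκ₂ hx
  obtain ⟨hr, -, hS, hC, hc, hs⟩ := hx
  have h4 := hasFDerivAt_comp_apply 4 (hasDerivAt_id' (x 4))
  have h5 := hasFDerivAt_comp_apply 5 (hasDerivAt_id' (x 5))
  have hcos := hasFDerivAt_comp_apply 2 (Real.hasDerivAt_cos (x 2))
  have hsin := hasFDerivAt_comp_apply 2 (Real.hasDerivAt_sin (x 2))
  have hZ := (hasFDerivAt_comp_apply 1 (hasDerivAt_Sk κ₂ (x 1))).fun_mul hsin
  have hX := (((hasFDerivAt_comp_apply 1 (hasDerivAt_Ck κ₂ (x 1))).fun_mul hsin).fun_mul h4).fun_add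
    ((hcos.fun_mul (hasFDerivAt_comp_apply 1 ((hasDerivAt_Sk κ₂ (x 1)).fun_inv hS))).fun_mul h5)
  have hL : L3 κ₁ κ₂ k β₁ β₂ =ᶠ[nhds x] fun y =>
      y 3 * (Ck κ₂ (y 1) * Real.sin (y 2) * y 4 + Real.cos (y 2) * (Sk κ₂ (y 1))⁻¹ * y 5)
      - 2 * κ₂ * (Ck κ₁ (y 0) / Sk κ₁ (y 0))
        * (Sk κ₂ (y 1) * Real.sin (y 2) * angularEnergy κ₂ β₁ β₂ 0 y)
      + k * κ₂ * (Sk κ₂ (y 1) * Real.sin (y 2)) := by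
    filter_upwards [eventually_Sk_ne_zero 1 hS] with y hS
    simp only [L3, J01, J02, J13, J23, Tk, angularEnergy, mul_inv, div_eq_mul_inv, inv_inv]
    linear_combination
      (Ck κ₁ (y 0) * (Sk κ₁ (y 0))⁻¹ * Sk κ₂ (y 1) * Real.sin (y 2)
        * (y 4 ^ 2 + (Sk κ₂ (y 1) ^ 2)⁻¹ * y 5 ^ 2)) * mul_inv_cancel₀ hκ₂
      + (y 3 * y 5 * Real.cos (y 2) * (Sk κ₂ (y 1))⁻¹) * Ck_sq_add κ₂ (y 1)
      + (-(y 3 * y 5 * Real.cos (y 2) * κ₂ * Sk κ₂ (y 1))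
        + Ck κ₁ (y 0) * (Sk κ₁ (y 0))⁻¹ * (-(Real.cos (y 2) * Ck κ₂ (y 1) * y 4 * y 5)
          + Real.sin (y 2) * y 5 ^ 2 * (Sk κ₂ (y 1))⁻¹
          + 2 * κ₂ * β₂ * Real.sin (y 2) * (Real.cos (y 2) ^ 2)⁻¹ * (Sk κ₂ (y 1))⁻¹))
        * mul_inv_cancel₀ hS
  rw [pb_congr_left hL, HGKC3_eq]
  refine pb_laplaceRungeLenz κ₁ κ₂ k hr hZ.differentiableAt hX.differentiableAt
    hN.differentiableAt ?_ ?_ ?_ ?_ ?_ ?_ ?_ ?_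
  all_goals simp only [pb_eq, pd, hZ.fderiv, hX.fderiv, hN.fderiv]
  all_goals simp
  · field_simp
  · simp only [angularEnergy]
    linear_combination (norm := (field_simp; ring))
      (2 * Real.sin (x 2) / Sk κ₂ (x 1) ^ 3
        * (x 5 ^ 2 / (2 * κ₂) + β₂ / Real.cos (x 2) ^ 2)) * Ck_sq_add κ₂ (x 1)

/-- for i, j ∈ {1,2,3} with j ≠ i, setting β_j = 0 in H^GKC_i
(which already involves no βᵢ, i.e. βᵢ = 0 throughout), both Lᵢ and L_j
(with βᵢ = β_j = 0 substituted in their formulas) Poisson commute with H^GKC_i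
at every point of D.  All six cases (i,j) are listed. -/
theorem GKC_two_integrals_commute (κ₁ κ₂ k β₁ β₂ β₃ : ℝ) (hκ₂ : κ₂ ≠ 0) :
    ∀ x ∈ D κ₁ κ₂,
      -- i = 1, j = 2 (β₁ absent, β₂ = 0)
      (pb (L1 κ₁ κ₂ k 0 β₃) (HGKC1 κ₁ κ₂ k 0 β₃) x = 0 ∧
       pb (L2 κ₁ κ₂ k 0 β₃) (HGKC1 κ₁ κ₂ k 0 β₃) x = 0) ∧
      -- i = 1, j = 3 (β₁ absent, β₃ = 0)
      (pb (L1 κ₁ κ₂ k β₂ 0) (HGKC1 κ₁ κ₂ k β₂ 0) x = 0 ∧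
       pb (L3 κ₁ κ₂ k 0 β₂) (HGKC1 κ₁ κ₂ k β₂ 0) x = 0) ∧
      -- i = 2, j = 1 (β₂ absent, β₁ = 0)
      (pb (L2 κ₁ κ₂ k 0 β₃) (HGKC2 κ₁ κ₂ k 0 β₃) x = 0 ∧
       pb (L1 κ₁ κ₂ k 0 β₃) (HGKC2 κ₁ κ₂ k 0 β₃) x = 0) ∧
      -- i = 2, j = 3 (β₂ absent, β₃ = 0)
      (pb (L2 κ₁ κ₂ k β₁ 0) (HGKC2 κ₁ κ₂ k β₁ 0) x = 0 ∧
       pb (L3 κ₁ κ₂ k β₁ 0) (HGKC2 κ₁ κ₂ k β₁ 0) x = 0) ∧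
      -- i = 3, j = 1 (β₃ absent, β₁ = 0)
      (pb (L3 κ₁ κ₂ k 0 β₂) (HGKC3 κ₁ κ₂ k 0 β₂) x = 0 ∧
       pb (L1 κ₁ κ₂ k β₂ 0) (HGKC3 κ₁ κ₂ k 0 β₂) x = 0) ∧
      -- i = 3, j = 2 (β₃ absent, β₂ = 0)
      (pb (L3 κ₁ κ₂ k β₁ 0) (HGKC3 κ₁ κ₂ k β₁ 0) x = 0 ∧
       pb (L2 κ₁ κ₂ k β₁ 0) (HGKC3 κ₁ κ₂ k β₁ 0) x = 0) := by
  intro x hx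
  have h12 (β : ℝ) : HGKC1 κ₁ κ₂ k 0 β = HGKC2 κ₁ κ₂ k 0 β := by rw [HGKC1_eq, HGKC2_eq]
  have h13 (β : ℝ) : HGKC1 κ₁ κ₂ k β 0 = HGKC3 κ₁ κ₂ k 0 β := by rw [HGKC1_eq, HGKC3_eq]
  have h23 (β : ℝ) : HGKC2 κ₁ κ₂ k β 0 = HGKC3 κ₁ κ₂ k β 0 := by rw [HGKC2_eq, HGKC3_eq]
  have hL₁ (β γ : ℝ) := pb_L1_HGKC1 k β γ hκ₂ hx
  have hL₂ (β γ : ℝ) := pb_L2_HGKC2 k β γ hκ₂ hx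
  have hL₃ (β γ : ℝ) := pb_L3_HGKC3 k β γ hκ₂ hx
  exact ⟨⟨hL₁ 0 β₃, h12 β₃ ▸ hL₂ 0 β₃⟩, ⟨hL₁ β₂ 0, h13 β₂ ▸ hL₃ 0 β₂⟩,
    ⟨hL₂ 0 β₃, h12 β₃ ▸ hL₁ 0 β₃⟩, ⟨hL₂ β₁ 0, h23 β₁ ▸ hL₃ β₁ 0⟩,
    ⟨hL₃ 0 β₂, h13 β₂ ▸ hL₁ β₂ 0⟩, ⟨hL₃ β₁ 0, h23 β₁ ▸ hL₂ β₁ 0⟩⟩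

end
end Paper
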